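/- For M > 0 and k > 0, the Melnikov function M(θ0) = −∫_{−∞}^{∞} √(2k) M² sech(Mt) tanh(Mt) sin(t + θ0) dt equals −π√(2k) sech(π/(2M)) cos θ0. -/

import Mathlib

theorem integrable_and_integral_sigmoid_cpow {u v : ℂ} (hu : 0 < u.re) (hv : 0 < v.re) :
    MeasureTheory.Integrable
        (fun t : ℝ => (Real.sigmoid t : ℂ) ^ u * (1 - (Real.sigmoid t : ℂ)) ^ v) ∧
      ∫ t : ℝ, (Real.sigmoid t : ℂ) ^ u * (1 - (Real.sigmoid t : ℂ)) ^ v =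
        Complex.betaIntegral u v := by
  have hderiv : ∀ x ∈ Set.univ, HasDerivWithinAt Real.sigmoid
      (Real.sigmoid x * (1 - Real.sigmoid x)) Set.univ x :=
    fun x _ => (Real.hasDerivAt_sigmoid x).hasDerivWithinAt
  have himage : Real.sigmoid '' Set.univ = Set.Ioo 0 1 := by
    rw [Set.image_univ, Real.range_sigmoid]
  have hpt : ∀ t : ℝ, |Real.sigmoid t * (1 - Real.sigmoid t)| •
      ((Real.sigmoid t : ℂ) ^ (u - 1) * (1 - (Real.sigmoid t : ℂ)) ^ (v - 1)) =
      (Real.sigmoid t : ℂ) ^ u * (1 - (Real.sigmoid t : ℂ)) ^ v := by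
    intro t
    have h0 := Real.sigmoid_pos t
    have h1 : 0 < 1 - Real.sigmoid t := sub_pos.2 (Real.sigmoid_lt_one t)
    have h0' : (Real.sigmoid t : ℂ) ≠ 0 := by exact_mod_cast h0.ne'
    have h1' : (1 - Real.sigmoid t : ℂ) ≠ 0 := by exact_mod_cast h1.ne'
    rw [abs_of_pos (mul_pos h0 h1), Complex.cpow_sub _ _ h0', Complex.cpow_sub _ _ h1',
      Complex.cpow_one, Complex.cpow_one, Complex.real_smul]
    push_cast
    field_simp
  have hinj := Real.sigmoid_injective.injOn (s := Set.univ)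
  constructor
  · have h := Complex.betaIntegral_convergent hu hv
    rw [intervalIntegrable_iff_integrableOn_Ioo_of_le zero_le_one, ← himage,
      MeasureTheory.integrableOn_image_iff_integrableOn_abs_deriv_smul MeasurableSet.univ
        hderiv hinj, MeasureTheory.integrableOn_univ] at h
    simpa only [hpt] using h
  · rw [Complex.betaIntegral, intervalIntegral.integral_of_le zero_le_one,
      MeasureTheory.integral_Ioc_eq_integral_Ioo, ← himage,
      MeasureTheory.integral_image_eq_integral_abs_deriv_smul MeasurableSet.univ
        hderiv hinj, MeasureTheory.setIntegral_univ]
    simp only [hpt]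

theorem sigmoid_two_mul (s : ℝ) :
    Real.sigmoid (2 * s) = Real.exp (s - Real.log (2 * Real.cosh s)) := by
  have hc := Real.cosh_pos s
  rw [Real.exp_sub, Real.exp_log (by positivity), Real.sigmoid_def, Real.cosh_eq,
    show -(2 * s) = -s + -s by ring, Real.exp_add, Real.exp_neg]
  field_simp

theorem ofReal_exp_cpow (a : ℝ) (u : ℂ) : ((Real.exp a : ℝ) : ℂ) ^ u = Complex.exp (a * u) := by
  rw [Complex.cpow_def_of_ne_zero (by exact_mod_cast (Real.exp_pos a).ne'), ← Complex.ofReal_log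
    (Real.exp_pos a).le, Real.log_exp]

theorem sigmoid_cpow_mul_cpow (ω s : ℝ) :
    (Real.sigmoid (2 * s) : ℂ) ^ (1 / 2 + ω * Complex.I) *
      (1 - (Real.sigmoid (2 * s) : ℂ)) ^ (1 / 2 - ω * Complex.I) =
      Complex.exp (2 * ω * s * Complex.I) / (2 * Real.cosh s : ℝ) := by
  have h1 : (1 - (Real.sigmoid (2 * s) : ℂ)) =
      (Real.exp (-s - Real.log (2 * Real.cosh s)) : ℝ) := by
    rw [← Real.cosh_neg s, ← sigmoid_two_mul, mul_neg, Real.sigmoid_neg]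
    push_cast
    rfl
  have hc := Real.cosh_pos s
  rw [h1, sigmoid_two_mul, ofReal_exp_cpow, ofReal_exp_cpow, ← Complex.exp_add]
  nth_rewrite 3 [← Real.exp_log (show 0 < 2 * Real.cosh s by positivity)]
  rw [Complex.ofReal_exp, ← Complex.exp_sub]
  congr 1
  push_cast
  ring

theorem two_mul_sigmoid_two_mul_sub_one (s : ℝ) :
    2 * Real.sigmoid (2 * s) - 1 = Real.tanh s := by
  have hc := Real.cosh_pos s
  rw [sigmoid_two_mul, Real.exp_sub, Real.exp_log (by positivity), Real.tanh_eq_sinh_div_cosh,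
    ← Real.cosh_add_sinh]
  field_simp
  ring

theorem betaIntegral_add_one_sub_betaIntegral_add_one {u v : ℂ} (hu : 0 < u.re) (hv : 0 < v.re)
    (huv : u + v = 1) :
    Complex.betaIntegral (u + 1) v - Complex.betaIntegral u (v + 1) =
      (u - v) * (Real.pi / Complex.sin (Real.pi * u)) := by
  have hu0 : u ≠ 0 := by rintro rfl; simp at hu
  have hv0 : v ≠ 0 := by rintro rfl; simp at hv
  have h1 := Complex.Gamma_mul_Gamma_eq_betaIntegral (s := u + 1) (t := v)
    (by simp; linarith) hv
  have h2 := Complex.Gamma_mul_Gamma_eq_betaIntegral (s := u) (t := v + 1)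
    hu (by simp; linarith)
  rw [Complex.Gamma_add_one _ hu0, show u + 1 + v = 1 + 1 by rw [← huv]; ring,
    Complex.Gamma_add_one _ one_ne_zero, Complex.Gamma_one] at h1
  rw [Complex.Gamma_add_one _ hv0, show u + (v + 1) = 1 + 1 by rw [← huv]; ring,
    Complex.Gamma_add_one _ one_ne_zero, Complex.Gamma_one] at h2
  rw [← Complex.Gamma_mul_Gamma_one_sub, show 1 - u = v by rw [← huv]; ring]
  linear_combination h2 - h1

theorem integrable_and_integral_exp_mul_sech_mul_tanh (ω : ℝ) :
    MeasureTheory.Integrable (fun s : ℝ =>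
        Complex.exp (2 * ω * s * Complex.I) * (1 / Real.cosh s * Real.tanh s : ℝ)) ∧
      ∫ s : ℝ, Complex.exp (2 * ω * s * Complex.I) * (1 / Real.cosh s * Real.tanh s : ℝ) =
        2 * ω * Real.pi / Real.cosh (Real.pi * ω) * Complex.I := by
  set u : ℂ := 1 / 2 + ω * Complex.I with hu_def
  set v : ℂ := 1 / 2 - ω * Complex.I with hv_def
  have hu : 0 < u.re := by simp [hu_def]
  have hv : 0 < v.re := by simp [hv_def]
  obtain ⟨hi1, he1⟩ := integrable_and_integral_sigmoid_cpow (u := u + 1) (v := v)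
    (by rw [Complex.add_re, Complex.one_re]; linarith) hv
  obtain ⟨hi2, he2⟩ := integrable_and_integral_sigmoid_cpow (u := u) (v := v + 1)
    hu (by rw [Complex.add_re, Complex.one_re]; linarith)
  have hi := (hi1.sub hi2).const_mul 2
  have he := MeasureTheory.integral_sub hi1 hi2
  rw [he1, he2, betaIntegral_add_one_sub_betaIntegral_add_one hu hv (by rw [hu_def, hv_def]; ring)]
    at he
  have hpt : ∀ s : ℝ,
      2 * ((Real.sigmoid (2 * s) : ℂ) ^ (u + 1) * (1 - (Real.sigmoid (2 * s) : ℂ)) ^ v -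
        (Real.sigmoid (2 * s) : ℂ) ^ u * (1 - (Real.sigmoid (2 * s) : ℂ)) ^ (v + 1)) =
      Complex.exp (2 * ω * s * Complex.I) * (1 / Real.cosh s * Real.tanh s : ℝ) := by
    intro s
    have h0 : (Real.sigmoid (2 * s) : ℂ) ≠ 0 := by exact_mod_cast (Real.sigmoid_pos _).ne'
    have h1 : (1 - Real.sigmoid (2 * s) : ℂ) ≠ 0 := by
      exact_mod_cast (sub_pos.2 (Real.sigmoid_lt_one (2 * s))).ne'
    have hc : (Real.cosh s : ℂ) ≠ 0 := by exact_mod_cast (Real.cosh_pos s).ne'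
    have key := sigmoid_cpow_mul_cpow ω s
    rw [← hu_def, ← hv_def] at key
    rw [Complex.cpow_add _ _ h0, Complex.cpow_add _ _ h1, Complex.cpow_one, Complex.cpow_one,
      ← two_mul_sigmoid_two_mul_sub_one]
    push_cast [-Complex.ofReal_cosh] at key ⊢
    field_simp at key ⊢
    linear_combination (2 * (Real.sigmoid (2 * s) : ℂ) - 1) * key
  have hsin : Complex.sin (Real.pi * u) = Real.cosh (Real.pi * ω) := by
    rw [show (Real.pi : ℂ) * u = (Real.pi * ω : ℝ) * Complex.I + Real.pi / 2 by
      rw [hu_def]; push_cast; ring, Complex.sin_add_pi_div_two, Complex.cos_mul_I,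
      Complex.ofReal_cosh]
  constructor
  · have h := hi.comp_mul_left' (R := 2) two_ne_zero
    exact h.congr (Filter.Eventually.of_forall hpt)
  · simp_rw [← hpt]
    rw [MeasureTheory.integral_const_mul, MeasureTheory.Measure.integral_comp_mul_left
      (fun y : ℝ => (Real.sigmoid y : ℂ) ^ (u + 1) * (1 - (Real.sigmoid y : ℂ)) ^ v -
        (Real.sigmoid y : ℂ) ^ u * (1 - (Real.sigmoid y : ℂ)) ^ (v + 1)) 2, he, hsin, hu_def, hv_def,
      abs_of_pos (by norm_num), Complex.real_smul]
    push_cast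
    ring

theorem melnikov_function_value (M k : ℝ) (hM : 0 < M) (hk : 0 < k) (θ0 : ℝ) :
    -∫ t : ℝ, Real.sqrt (2*k) * M^2 * (1 / Real.cosh (M*t)) * Real.tanh (M*t)
        * Real.sin (t + θ0)
      = -(Real.pi * Real.sqrt (2*k) * (1 / Real.cosh (Real.pi / (2*M)))
          * Real.cos θ0) := by
  obtain ⟨hi, he⟩ := integrable_and_integral_exp_mul_sech_mul_tanh (1 / (2 * M))
  have hi' := (hi.comp_mul_left' hM.ne').const_mul
    (((Real.sqrt (2 * k) * M ^ 2 : ℝ) : ℂ) * Complex.exp (θ0 * Complex.I))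
  have hpt : ∀ t : ℝ, Real.sqrt (2*k) * M^2 * (1 / Real.cosh (M*t)) * Real.tanh (M*t)
        * Real.sin (t + θ0) =
      RCLike.im ((((Real.sqrt (2 * k) * M ^ 2 : ℝ) : ℂ) * Complex.exp (θ0 * Complex.I)) *
        (Complex.exp (2 * (1 / (2 * M) : ℝ) * (M * t : ℝ) * Complex.I) *
          (1 / Real.cosh (M * t) * Real.tanh (M * t) : ℝ))) := by
    intro t
    have hM' : (M : ℂ) ≠ 0 := by exact_mod_cast hM.ne'
    have hexp : Complex.exp (θ0 * Complex.I) *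
        Complex.exp (2 * (1 / (2 * M) : ℝ) * (M * t : ℝ) * Complex.I) =
        Complex.exp ((t + θ0 : ℝ) * Complex.I) := by
      rw [← Complex.exp_add]
      congr 1
      push_cast
      field_simp
      ring
    rw [show ∀ a b c d : ℂ, a * b * (c * d) = a * d * (b * c) by intros; ring, hexp,
      ← Complex.ofReal_mul, RCLike.im_eq_complex_im, Complex.im_ofReal_mul,
      Complex.exp_ofReal_mul_I_im]
    ring
  simp_rw [hpt]
  rw [integral_im hi', MeasureTheory.integral_const_mul,
    MeasureTheory.Measure.integral_comp_mul_left (fun s : ℝ =>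
      Complex.exp (2 * (1 / (2 * M) : ℝ) * s * Complex.I) *
        (1 / Real.cosh s * Real.tanh s : ℝ)) M, he, abs_of_pos (inv_pos.2 hM),
    Complex.real_smul]
  have hval : (((Real.sqrt (2 * k) * M ^ 2 : ℝ) : ℂ) * Complex.exp (θ0 * Complex.I)) *
      ((M⁻¹ : ℝ) * (2 * (1 / (2 * M) : ℝ) * Real.pi /
        Real.cosh (Real.pi * (1 / (2 * M))) * Complex.I)) =
      (Real.pi * Real.sqrt (2 * k) * (1 / Real.cosh (Real.pi / (2 * M))) : ℝ) *
        (Complex.exp (θ0 * Complex.I) * Complex.I) := by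
    have hM' : (M : ℂ) ≠ 0 := by exact_mod_cast hM.ne'
    rw [mul_one_div]
    push_cast [-Complex.ofReal_cosh]
    field_simp
  rw [hval, RCLike.im_eq_complex_im, Complex.im_ofReal_mul, Complex.mul_I_im,
    Complex.exp_ofReal_mul_I_re]
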